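/- There is an absolute constant C > 0 such that for all integers N ≥ m ≥ 1, |(1/N!)·#{σ ∈ S_N : σ has no cycle of length ≤ m} − ∏_{j=1}^m e^{−1/j}| ≤ C·m²/N. -/

import Mathlib

/-- The order of the centralizer of a permutation whose multiset of cycle lengths is `s`. -/
def cycleTypeCentralizerOrder (s : Multiset ℕ) : ℕ :=
  s.prod * ∏ n ∈ s.toFinset, (s.count n).factorial

theorem cycleTypeCentralizerOrder_eq_mul_erase {s : Multiset ℕ} {a : ℕ} (ha : a ∈ s) :
    cycleTypeCentralizerOrder s = a * s.count a * cycleTypeCentralizerOrder (s.erase a) := by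
  have hsub : ∏ n ∈ (s.erase a).toFinset, ((s.erase a).count n).factorial =
      ∏ n ∈ s.toFinset, ((s.erase a).count n).factorial := by
    refine Finset.prod_subset (fun x hx => ?_) (fun x _ hx => ?_)
    · rw [Multiset.mem_toFinset] at hx ⊢
      exact Multiset.mem_of_mem_erase hx
    · rw [Multiset.mem_toFinset] at hx
      rw [Multiset.count_eq_zero_of_notMem hx, Nat.factorial_zero]
  have ha' : a ∈ s.toFinset := Multiset.mem_toFinset.2 ha
  have hrest : ∏ n ∈ s.toFinset.erase a, ((s.erase a).count n).factorial =
      ∏ n ∈ s.toFinset.erase a, (s.count n).factorial :=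
    Finset.prod_congr rfl fun n hn => by
      rw [Multiset.count_erase_of_ne (Finset.ne_of_mem_erase hn)]
  have hpos : s.count a ≠ 0 := Multiset.count_ne_zero.2 ha
  unfold cycleTypeCentralizerOrder
  rw [hsub, ← Finset.mul_prod_erase _ _ ha', ← Finset.mul_prod_erase _ _ ha', hrest,
    Multiset.count_erase_self, ← Multiset.prod_erase ha, ← Nat.mul_factorial_pred hpos]
  ring

/-- The multisets of integers larger than `m` with sum `N`. -/
def partsAbove (m N : ℕ) : Finset (Multiset ℕ) :=
  ((Finset.univ : Finset N.Partition).image Nat.Partition.parts).filter fun s => ∀ l ∈ s, m < l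

theorem mem_partsAbove {m N : ℕ} {s : Multiset ℕ} :
    s ∈ partsAbove m N ↔ s.sum = N ∧ ∀ l ∈ s, m < l := by
  simp only [partsAbove, Finset.mem_filter, Finset.mem_image, Finset.mem_univ, true_and]
  constructor
  · rintro ⟨⟨p, rfl⟩, h⟩
    exact ⟨p.parts_sum, h⟩
  · rintro ⟨hs, h⟩
    exact ⟨⟨⟨s, fun hi => (Nat.zero_le m).trans_lt (h _ hi), hs⟩, rfl⟩, h⟩

/-- The density, in the symmetric group on `N` letters, of the permutations all of whose cycles are
longer than `m`, as a sum over cycle types. -/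
noncomputable def longCycleDensity (m N : ℕ) : ℝ :=
  ∑ s ∈ partsAbove m N, (cycleTypeCentralizerOrder s : ℝ)⁻¹

theorem cycleTypeCentralizerOrder_pos {s : Multiset ℕ} (hs : ∀ l ∈ s, 0 < l) :
    0 < cycleTypeCentralizerOrder s :=
  Nat.mul_pos (Nat.pos_of_ne_zero (Multiset.prod_ne_zero fun h => (hs 0 h).ne rfl))
    (Finset.prod_pos fun _ _ => Nat.factorial_pos _)

theorem longCycleDensity_zero (m : ℕ) : longCycleDensity m 0 = 1 := by
  have h : partsAbove m 0 = {0} := by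
    ext s
    rw [mem_partsAbove, Finset.mem_singleton]
    constructor
    · rintro ⟨hs, h⟩
      refine Multiset.eq_zero_of_forall_notMem fun a ha => ?_
      have := Multiset.sum_eq_zero_iff.1 hs a ha
      have := h a ha
      omega
    · rintro rfl
      simp
  simp [longCycleDensity, h, cycleTypeCentralizerOrder]

theorem longCycleDensity_nonneg (m N : ℕ) : 0 ≤ longCycleDensity m N :=
  Finset.sum_nonneg fun _ _ => inv_nonneg.2 (Nat.cast_nonneg _)

theorem mul_longCycleDensity (m N : ℕ) :
    N * longCycleDensity m N = ∑ i ∈ Finset.range (N - m), longCycleDensity m i := by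
  have hexp : ∀ s ∈ partsAbove m N, (N : ℝ) * (cycleTypeCentralizerOrder s : ℝ)⁻¹ =
      ∑ a ∈ s.toFinset, (cycleTypeCentralizerOrder (s.erase a) : ℝ)⁻¹ := by
    intro s hs
    obtain ⟨hsum, hlt⟩ := mem_partsAbove.1 hs
    rw [← hsum, Finset.sum_multiset_count, Nat.cast_sum, Finset.sum_mul]
    refine Finset.sum_congr rfl fun a ha => ?_
    rw [Multiset.mem_toFinset] at ha
    have h0 : (a : ℝ) ≠ 0 := Nat.cast_ne_zero.2 (Nat.ne_zero_of_lt (hlt a ha))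
    have h1 : (s.count a : ℝ) ≠ 0 := Nat.cast_ne_zero.2 (Multiset.count_ne_zero.2 ha)
    rw [cycleTypeCentralizerOrder_eq_mul_erase ha]
    push_cast
    rw [smul_eq_mul, Nat.cast_mul, mul_inv, mul_comm (a : ℝ), ← mul_assoc,
      mul_inv_cancel₀ (mul_ne_zero h1 h0), one_mul]
  unfold longCycleDensity
  rw [Finset.mul_sum, Finset.sum_congr rfl hexp, Finset.sum_sigma', Finset.sum_sigma']
  refine Finset.sum_bij' (fun p _ => ⟨N - p.2, p.1.erase p.2⟩)
    (fun q _ => ⟨(N - q.1) ::ₘ q.2, N - q.1⟩) ?_ ?_ ?_ ?_ ?_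
  · rintro ⟨s, a⟩ h
    simp only [Finset.mem_sigma, Finset.mem_range, mem_partsAbove, Multiset.mem_toFinset] at h ⊢
    obtain ⟨⟨hsum, hlt⟩, ha⟩ := h
    have h1 := hlt a ha
    have h2 := Multiset.sum_erase ha
    refine ⟨by omega, by omega, fun l hl => hlt l (Multiset.mem_of_mem_erase hl)⟩
  · rintro ⟨i, t⟩ h
    simp only [Finset.mem_sigma, Finset.mem_range, mem_partsAbove, Multiset.mem_toFinset,
      Multiset.sum_cons, Multiset.mem_cons] at h ⊢
    obtain ⟨hi, hsum, hlt⟩ := h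
    refine ⟨⟨by omega, ?_⟩, by simp⟩
    rintro l (rfl | hl)
    · omega
    · exact hlt l hl
  · rintro ⟨s, a⟩ h
    simp only [Finset.mem_sigma, mem_partsAbove, Multiset.mem_toFinset] at h
    obtain ⟨⟨hsum, hlt⟩, ha⟩ := h
    have h2 := Multiset.sum_erase ha
    have h3 : N - (N - a) = a := by omega
    simp [h3, Multiset.cons_erase ha]
  · rintro ⟨i, t⟩ h
    simp only [Finset.mem_sigma, Finset.mem_range] at h
    have h3 : N - (N - i) = i := by omega
    simp [h3]
  · intros
    rfl

theorem longCycleDensity_le_one (m N : ℕ) : longCycleDensity m N ≤ 1 := by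
  induction N using Nat.strong_induction_on with
  | _ N ih =>
    rcases Nat.eq_zero_or_pos N with rfl | hN
    · exact (longCycleDensity_zero m).le
    have hN' : (0 : ℝ) < N := Nat.cast_pos.2 hN
    refine le_of_mul_le_mul_left ?_ hN'
    rw [mul_longCycleDensity]
    calc ∑ i ∈ Finset.range (N - m), longCycleDensity m i
        ≤ ∑ _i ∈ Finset.range (N - m), (1 : ℝ) :=
          Finset.sum_le_sum fun i hi => ih i (by rw [Finset.mem_range] at hi; omega)
      _ ≤ N * 1 := by simp

theorem card_noShortCycles_div_factorial {m : ℕ} (hm : 1 ≤ m) (N : ℕ) :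
    (Nat.card {σ : Equiv.Perm (Fin N) //
      (∀ x, σ x ≠ x) ∧ ∀ l ∈ σ.cycleType, m < l} : ℝ) / (N.factorial : ℝ) =
    longCycleDensity m N := by
  classical
  have hmem (σ : Equiv.Perm (Fin N)) : ((∀ x, σ x ≠ x) ∧ ∀ l ∈ σ.cycleType, m < l) ↔
      σ.cycleType ∈ partsAbove m N := by
    rw [mem_partsAbove, Equiv.Perm.sum_cycleType]
    refine and_congr_left fun _ => ?_
    have := Finset.card_eq_iff_eq_univ σ.support
    rw [Fintype.card_fin] at this
    rw [this, Finset.eq_univ_iff_forall]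
    simp only [Equiv.Perm.mem_support]
  have hfact : (N.factorial : ℝ) ≠ 0 := Nat.cast_ne_zero.2 N.factorial_ne_zero
  have hfiber := Finset.card_eq_sum_card_fiberwise (f := Equiv.Perm.cycleType)
    (s := Finset.univ.filter fun σ : Equiv.Perm (Fin N) => σ.cycleType ∈ partsAbove m N)
    (t := partsAbove m N) fun σ hσ => (Finset.mem_filter.1 hσ).2
  rw [Nat.card_eq_fintype_card, Fintype.card_subtype, Finset.filter_congr fun σ _ => hmem σ,
    hfiber, Nat.cast_sum, Finset.sum_div]
  refine Finset.sum_congr rfl fun s hs => ?_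
  obtain ⟨hsum, hlt⟩ := mem_partsAbove.1 hs
  have hcard := Equiv.Perm.card_of_cycleType_mul_eq (Fin N) s
  rw [Fintype.card_fin, if_pos ⟨hsum.le, fun a ha => by have := hlt a ha; omega⟩, hsum,
    Nat.sub_self, Nat.factorial_zero, one_mul] at hcard
  have hfilter : (Finset.univ.filter fun σ : Equiv.Perm (Fin N) =>
        σ.cycleType ∈ partsAbove m N).filter (fun σ => σ.cycleType = s) =
      Finset.univ.filter fun σ : Equiv.Perm (Fin N) => σ.cycleType = s := by
    ext σ
    simp only [Finset.mem_filter, Finset.mem_univ, true_and, and_iff_right_iff_imp]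
    rintro rfl
    exact hs
  have hz : (cycleTypeCentralizerOrder s : ℝ) ≠ 0 := Nat.cast_ne_zero.2
    (cycleTypeCentralizerOrder_pos fun l hl => (Nat.zero_le m).trans_lt (hlt l hl)).ne'
  rw [hfilter, div_eq_iff hfact, ← hcard, Nat.cast_mul]
  rw [cycleTypeCentralizerOrder] at hz ⊢
  field_simp

theorem HasSum.mul_pow_shift {a : ℕ → ℝ} {x A : ℝ} (h : HasSum (fun n => a n * x ^ n) A) (k : ℕ) :
    HasSum (fun n => (if k ≤ n then a (n - k) else 0) * x ^ n) (x ^ k * A) := by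
  have hzero : ∑ n ∈ Finset.range k, (if k ≤ n then a (n - k) else 0) * x ^ n = 0 :=
    Finset.sum_eq_zero fun n hn => by
      rw [if_neg (not_le.2 (Finset.mem_range.1 hn)), zero_mul]
  rw [← hasSum_nat_add_iff' k, hzero, sub_zero]
  refine (h.mul_left (x ^ k)).congr_fun fun n => ?_
  rw [if_pos (Nat.le_add_left k n), Nat.add_sub_cancel, pow_add]
  ring

theorem abs_sub_le_mul_of_abs_succ_sub_le {a : ℕ → ℝ} {B : ℝ} {n : ℕ} (j : ℕ)
    (h : ∀ k, n ≤ k → k < n + j → |a (k + 1) - a k| ≤ B) : |a (n + j) - a n| ≤ j * B := by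
  induction j with
  | zero => simp
  | succ j ih =>
    have h1 := ih fun k hk hk' => h k hk (by omega)
    have h2 := h (n + j) (by omega) (by omega)
    have h3 := abs_sub_le (a (n + j + 1)) (a (n + j)) (a n)
    rw [← add_assoc]
    push_cast
    linarith

/-- The recursion satisfied by the densities of permutations without cycles of length at most `m`. -/
structure IsLongCycleSequence (m : ℕ) (a : ℕ → ℝ) : Prop where
  zero : a 0 = 1
  nonneg : ∀ n, 0 ≤ a n
  le_one : ∀ n, a n ≤ 1
  mul_eq : ∀ n : ℕ, n * a n = ∑ i ∈ Finset.range (n - m), a i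

namespace IsLongCycleSequence

variable {m : ℕ} {a : ℕ → ℝ}

theorem succ_mul_sub (h : IsLongCycleSequence m a) (n : ℕ) :
    ((n : ℝ) + 1) * (a (n + 1) - a n) = (if m ≤ n then a (n - m) else 0) - a n := by
  have h1 := h.mul_eq (n + 1)
  have h2 := h.mul_eq n
  push_cast at h1
  split_ifs with hmn
  · rw [Nat.sub_add_comm hmn, Finset.sum_range_succ, ← h2] at h1
    linarith
  · rw [Nat.sub_eq_zero_of_le (by omega), Finset.sum_range_zero] at h1 h2
    linarith

theorem abs_sub_le_one (h : IsLongCycleSequence m a) (i j : ℕ) : |a i - a j| ≤ 1 :=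
  abs_sub_le_of_nonneg_of_le (h.nonneg i) (h.le_one i) (h.nonneg j) (h.le_one j)

theorem succ_mul_abs_sub (h : IsLongCycleSequence m a) {n : ℕ} (hmn : m ≤ n) :
    ((n : ℝ) + 1) * |a (n + 1) - a n| = |a (n - m + m) - a (n - m)| := by
  rw [Nat.sub_add_cancel hmn, abs_sub_comm (a n)]
  have h1 := h.succ_mul_sub n
  rw [if_pos hmn] at h1
  rw [← h1, abs_mul, abs_of_nonneg (by positivity : (0 : ℝ) ≤ (n : ℝ) + 1)]

theorem abs_succ_sub_le (h : IsLongCycleSequence m a) (n : ℕ) :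
    |a (n + 1) - a n| ≤ 1 / ((n : ℝ) + 1) := by
  have hpos : (0 : ℝ) < (n : ℝ) + 1 := by positivity
  rw [le_div_iff₀' hpos]
  rcases le_or_gt m n with hmn | hmn
  · rw [h.succ_mul_abs_sub hmn]
    exact h.abs_sub_le_one _ _
  · have h1 := h.succ_mul_sub n
    rw [if_neg (by omega), zero_sub] at h1
    rw [← abs_of_pos hpos, ← abs_mul, h1, abs_neg, abs_of_nonneg (h.nonneg n)]
    exact h.le_one n

theorem abs_succ_sub_le_div_sq (h : IsLongCycleSequence m a) (hm : 1 ≤ m) {n : ℕ}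
    (hn : 2 * m ≤ n + 1) : |a (n + 1) - a n| ≤ 2 * m / ((n : ℝ) + 1) ^ 2 := by
  have hpos : (0 : ℝ) < (n : ℝ) + 1 := by positivity
  have hn' : 2 * (m : ℝ) ≤ n + 1 := by exact_mod_cast hn
  have h1 : |a (n - m + m) - a (n - m)| ≤ m * (2 / ((n : ℝ) + 1)) := by
    refine abs_sub_le_mul_of_abs_succ_sub_le m fun k hk _ => (h.abs_succ_sub_le k).trans ?_
    have hk' : (n : ℝ) ≤ k + m := by exact_mod_cast (by omega : n ≤ k + m)
    rw [div_le_div_iff₀ (by positivity) hpos]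
    linarith
  rw [← h.succ_mul_abs_sub (by omega)] at h1
  rw [le_div_iff₀ (by positivity)]
  calc |a (n + 1) - a n| * ((n : ℝ) + 1) ^ 2
      = ((n + 1) * |a (n + 1) - a n|) * (n + 1) := by ring
    _ ≤ (m * (2 / ((n : ℝ) + 1))) * (n + 1) := by gcongr
    _ = 2 * m := by field_simp

theorem succ_mul_abs_sub_le_div_sq (h : IsLongCycleSequence m a) (hm : 1 ≤ m) {n : ℕ}
    (hn : 3 * m ≤ n + 1) :
    ((n : ℝ) + 1) * |a (n + 1) - a n| ≤ 8 * m ^ 2 * (1 / ((n : ℝ) + 1) ^ 2) := by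
  have hn' : 3 * (m : ℝ) ≤ n + 1 := by exact_mod_cast hn
  rw [h.succ_mul_abs_sub (by omega)]
  calc |a (n - m + m) - a (n - m)| ≤ m * (8 * m / ((n : ℝ) + 1) ^ 2) := by
        refine abs_sub_le_mul_of_abs_succ_sub_le m fun k hk _ =>
          (h.abs_succ_sub_le_div_sq hm (by omega)).trans ?_
        have hk' : (n : ℝ) ≤ k + m := by exact_mod_cast (by omega : n ≤ k + m)
        have hle : ((n : ℝ) + 1) / 2 ≤ k + 1 := by
          have : (0 : ℝ) ≤ m := Nat.cast_nonneg m
          linarith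
        calc 2 * (m : ℝ) / ((k : ℝ) + 1) ^ 2 ≤ 2 * m / (((n : ℝ) + 1) / 2) ^ 2 := by gcongr
          _ = 8 * m / ((n : ℝ) + 1) ^ 2 := by field_simp; norm_num
    _ = 8 * m ^ 2 * (1 / ((n : ℝ) + 1) ^ 2) := by ring

/-- The coefficients of `(1 - x) * ∑ n, a n * x ^ n`. -/
def diff (a : ℕ → ℝ) (n : ℕ) : ℝ := a n - if 1 ≤ n then a (n - 1) else 0

theorem diff_succ (a : ℕ → ℝ) (n : ℕ) : diff a (n + 1) = a (n + 1) - a n := by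
  simp [diff]

theorem sum_range_diff (a : ℕ → ℝ) (n : ℕ) : ∑ i ∈ Finset.range (n + 1), diff a i = a n := by
  induction n with
  | zero => simp [diff]
  | succ n ih => rw [Finset.sum_range_succ, ih, diff_succ]; ring

theorem summable_mul_diff (h : IsLongCycleSequence m a) (hm : 1 ≤ m) :
    Summable fun n : ℕ => (n : ℝ) * |diff a n| := by
  rw [← summable_nat_add_iff 1]
  have hg : Summable fun n : ℕ => 8 * (m : ℝ) ^ 2 * (1 / ((n : ℝ) + 1) ^ 2) := by
    refine Summable.mul_left _ ?_
    have := (summable_nat_add_iff 1).2 (Real.summable_one_div_nat_pow.2 one_lt_two)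
    simpa using this
  refine Summable.of_norm_bounded_eventually_nat hg ?_
  filter_upwards [Filter.eventually_ge_atTop (3 * m)] with n hn
  rw [diff_succ, Real.norm_of_nonneg (by positivity), Nat.cast_add_one]
  exact h.succ_mul_abs_sub_le_div_sq hm (by omega)

theorem summable_abs_diff (h : IsLongCycleSequence m a) (hm : 1 ≤ m) :
    Summable fun n : ℕ => |diff a n| := by
  have h1 := (summable_nat_add_iff 1).2 (h.summable_mul_diff hm)
  rw [← summable_nat_add_iff 1]
  refine Summable.of_nonneg_of_le (fun _ => abs_nonneg _) (fun n => ?_) h1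
  refine le_mul_of_one_le_left (abs_nonneg _) ?_
  push_cast
  linarith [(Nat.cast_nonneg n : (0 : ℝ) ≤ n)]

theorem hasDerivAt_tsum_diff (h : IsLongCycleSequence m a) (hm : 1 ≤ m) {x : ℝ}
    (hx : x ∈ Set.Ioo (-1 : ℝ) 1) :
    HasDerivAt (fun y => ∑' n, diff a n * y ^ n)
      (-(∑ i ∈ Finset.range m, x ^ i) * ∑' n, diff a n * x ^ n) x := by
  have hx' : |x| < 1 := abs_lt.2 hx
  have hA : Summable fun n => a n * x ^ n := by
    refine Summable.of_norm_bounded (summable_geometric_of_lt_one (abs_nonneg x) hx') fun n => ?_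
    rw [norm_mul, norm_pow, Real.norm_of_nonneg (h.nonneg n), Real.norm_eq_abs]
    exact mul_le_of_le_one_left (by positivity) (h.le_one n)
  have hF : HasSum (fun n => diff a n * x ^ n) ((1 - x) * ∑' n, a n * x ^ n) := by
    have hshift := hA.hasSum.mul_pow_shift 1
    rw [pow_one] at hshift
    rw [sub_mul, one_mul]
    refine (hA.hasSum.sub hshift).congr_fun fun n => ?_
    rw [diff, sub_mul]
  have hF' : HasSum (fun n : ℕ => diff a n * (n * x ^ (n - 1)))
      ((x ^ m - 1) * ∑' n, a n * x ^ n) := by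
    rw [← hasSum_nat_add_iff' 1]
    convert (hA.hasSum.mul_pow_shift m).sub hA.hasSum using 1
    · funext n
      rw [diff_succ, ← sub_mul, ← h.succ_mul_sub n]
      rw [Nat.add_sub_cancel, Nat.cast_add_one]
      ring
    · simp
      ring
  have hval : -(∑ i ∈ Finset.range m, x ^ i) * ∑' n, diff a n * x ^ n =
      ∑' n : ℕ, diff a n * (n * x ^ (n - 1)) := by
    rw [hF.tsum_eq, hF'.tsum_eq, ← neg_sub 1 (x ^ m), ← geom_sum_mul_neg]
    ring
  rw [hval]
  refine hasDerivAt_tsum_of_isPreconnected (h.summable_mul_diff hm) isOpen_Ioo isPreconnected_Ioo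
    (fun n y _ => (hasDerivAt_pow n y).const_mul (diff a n)) (fun n y hy => ?_) hx hF.summable hx
  rw [norm_mul, norm_mul, norm_pow, Real.norm_natCast, Real.norm_eq_abs, Real.norm_eq_abs,
    mul_comm, mul_assoc]
  have hy' : |y| ≤ 1 := (abs_lt.2 hy).le
  refine mul_le_mul_of_nonneg_left ?_ (Nat.cast_nonneg n)
  exact mul_le_of_le_one_left (abs_nonneg _) (pow_le_one₀ (abs_nonneg y) hy')

theorem tsum_diff_eq (h : IsLongCycleSequence m a) (hm : 1 ≤ m) :
    ∑' n, diff a n = Real.exp (-∑ i ∈ Finset.range m, 1 / ((i : ℝ) + 1)) := by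
  let F : ℝ → ℝ := fun x => ∑' n, diff a n * x ^ n
  let P : ℝ → ℝ := fun x => ∑ i ∈ Finset.range m, x ^ (i + 1) / ((i : ℝ) + 1)
  have hP (x : ℝ) : HasDerivAt P (∑ i ∈ Finset.range m, x ^ i) x := by
    refine HasDerivAt.fun_sum fun i _ => ?_
    have hi : (i : ℝ) + 1 ≠ 0 := by positivity
    refine ((hasDerivAt_pow (i + 1) x).div_const ((i : ℝ) + 1)).congr_deriv ?_
    rw [Nat.add_sub_cancel, Nat.cast_add_one]
    field_simp
  have hFcont : ContinuousOn F (Set.Icc 0 1) := by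
    refine continuousOn_tsum (fun n => by fun_prop) (h.summable_abs_diff hm) fun n x hx => ?_
    rw [norm_mul, norm_pow, Real.norm_eq_abs, Real.norm_of_nonneg hx.1]
    exact mul_le_of_le_one_right (abs_nonneg _) (pow_le_one₀ hx.1 hx.2)
  have hPcont : Continuous P := continuous_iff_continuousAt.2 fun x => (hP x).continuousAt
  have hconst := constant_of_has_deriv_right_zero (f := fun x => F x * Real.exp (P x))
    (a := 0) (b := 1) (hFcont.mul (Real.continuous_exp.comp hPcont).continuousOn)
    (fun x hx => by
      have hd := (h.hasDerivAt_tsum_diff hm (x := x) ⟨by linarith [hx.1], hx.2⟩).mul (hP x).exp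
      refine (hd.congr_deriv ?_).hasDerivWithinAt
      ring) 1 (by simp)
  have hF0 : F 0 = 1 := by
    have : F 0 = diff a 0 * 0 ^ 0 := tsum_eq_single 0 fun n hn => by simp [hn]
    rw [this]
    simp [diff, h.zero]
  have hP0 : P 0 = 0 := by simp [P]
  have hF1 : F 1 = ∑' n, diff a n := by simp [F]
  have hP1 : P 1 = ∑ i ∈ Finset.range m, 1 / ((i : ℝ) + 1) := by simp [P]
  simp only [hF0, hP0, hF1, hP1, Real.exp_zero, mul_one] at hconst
  rw [Real.exp_neg, eq_inv_of_mul_eq_one_left hconst]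

theorem tendsto (h : IsLongCycleSequence m a) (hm : 1 ≤ m) :
    Filter.Tendsto a Filter.atTop
      (nhds (Real.exp (-∑ i ∈ Finset.range m, 1 / ((i : ℝ) + 1)))) := by
  have h1 := (h.summable_abs_diff hm).of_abs.hasSum.tendsto_sum_nat
  rw [h.tsum_diff_eq hm, ← Filter.tendsto_add_atTop_iff_nat 1] at h1
  simpa only [sum_range_diff] using h1

theorem abs_sub_le_of_two_mul_le (h : IsLongCycleSequence m a) (hm : 1 ≤ m) {N : ℕ}
    (hN : 2 * m ≤ N) (k : ℕ) :
    |a (N + k) - a N| ≤ 2 * m * (1 / (N : ℝ) - 1 / ((N + k : ℕ) : ℝ)) := by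
  induction k with
  | zero => simp
  | succ k ih =>
    have h1 := h.abs_succ_sub_le_div_sq hm (n := N + k) (by omega)
    have h2 := abs_sub_le (a (N + k + 1)) (a (N + k)) (a N)
    have hpos : (0 : ℝ) < (N + k : ℕ) := Nat.cast_pos.2 (by omega)
    have h3 : 2 * (m : ℝ) / (((N + k : ℕ) : ℝ) + 1) ^ 2 ≤
        2 * m * (1 / ((N + k : ℕ) : ℝ) - 1 / (((N + k : ℕ) : ℝ) + 1)) := by
      rw [div_eq_mul_one_div]
      refine mul_le_mul_of_nonneg_left ?_ (by positivity)
      rw [div_sub_div _ _ hpos.ne' (by positivity), div_le_div_iff₀ (by positivity) (by positivity)]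
      nlinarith
    rw [← add_assoc, Nat.cast_add_one]
    linarith

theorem abs_sub_exp_le (h : IsLongCycleSequence m a) (hm : 1 ≤ m) {N : ℕ} (hN : 2 * m ≤ N) :
    |a N - Real.exp (-∑ i ∈ Finset.range m, 1 / ((i : ℝ) + 1))| ≤ 2 * m / N := by
  have hlim := (((Filter.tendsto_add_atTop_iff_nat N).2 (h.tendsto hm)).sub_const (a N)).abs
  rw [abs_sub_comm]
  refine le_of_tendsto' hlim fun k => ?_
  rw [add_comm k N]
  refine (h.abs_sub_le_of_two_mul_le hm hN k).trans ?_
  rw [div_eq_mul_one_div (2 * (m : ℝ))]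
  exact mul_le_mul_of_nonneg_left (sub_le_self _ (by positivity)) (by positivity)

end IsLongCycleSequence

theorem prod_exp_neg_one_div (m : ℕ) :
    ∏ j ∈ Finset.Icc 1 m, Real.exp (-(1 / (j : ℝ))) =
      Real.exp (-∑ i ∈ Finset.range m, 1 / ((i : ℝ) + 1)) := by
  induction m with
  | zero => simp
  | succ m ih =>
    rw [Finset.prod_Icc_succ_top (by omega), ih, Finset.sum_range_succ, neg_add, Real.exp_add,
      Nat.cast_add_one]

theorem isLongCycleSequence_longCycleDensity (m : ℕ) :
    IsLongCycleSequence m (longCycleDensity m) where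
  zero := longCycleDensity_zero m
  nonneg := longCycleDensity_nonneg m
  le_one := longCycleDensity_le_one m
  mul_eq := mul_longCycleDensity m


/-- There is an absolute constant `C > 0` such that for all integers `N ≥ m ≥ 1`,
`|(1/N!)·#{σ ∈ S_N : σ has no cycle of length ≤ m} − ∏_{j=1}^m e^{−1/j}| ≤ C·m²/N`.
(Since `m ≥ 1`, "no cycle of length ≤ m" means: no fixed points, and every
nontrivial cycle has length `> m`.) -/
theorem no_short_cycles_density :
    ∃ C : ℝ, 0 < C ∧ ∀ N m : ℕ, 1 ≤ m → m ≤ N →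
      |(Nat.card {σ : Equiv.Perm (Fin N) //
            (∀ x, σ x ≠ x) ∧ ∀ l ∈ σ.cycleType, m < l} : ℝ) / (N.factorial : ℝ) -
          ∏ j ∈ Finset.Icc 1 m, Real.exp (-(1 / (j : ℝ)))| ≤
        C * (m : ℝ) ^ 2 / (N : ℝ) := by
  refine ⟨2, two_pos, fun N m hm hmN => ?_⟩
  have h := isLongCycleSequence_longCycleDensity m
  have hm' : (1 : ℝ) ≤ m := Nat.one_le_cast.2 hm
  have hN : (0 : ℝ) < N := Nat.cast_pos.2 (by omega)
  rw [card_noShortCycles_div_factorial hm, prod_exp_neg_one_div]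
  rcases le_or_gt (2 * m) N with hle | hlt
  · refine (h.abs_sub_exp_le hm hle).trans ?_
    gcongr
    nlinarith
  · have hexp : Real.exp (-∑ i ∈ Finset.range m, 1 / ((i : ℝ) + 1)) ≤ 1 :=
      Real.exp_le_one_iff.2 (neg_nonpos.2 (Finset.sum_nonneg fun i _ => by positivity))
    refine (abs_sub_le_of_nonneg_of_le (h.nonneg N) (h.le_one N) (Real.exp_pos _).le hexp).trans ?_
    have hlt' : (N : ℝ) < 2 * m := by exact_mod_cast hlt
    rw [le_div_iff₀ hN]
    nlinarith
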